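/- Consider any σ ∈ S_non(1/3) and any constant δ > 0. There exists a constant C_{G,δ} depending only on G and δ such that for any T ≥ C_{G,δ}·n, the product replacement chain started at σ satisfies Pr_σ(σ_T ∉ S_*(δ)) ≤ 1/n for all large enough n. -/

import Mathlib

open scoped BigOperators
open Filter

attribute [local instance] Classical.propDecidable

noncomputable section

namespace PR

variable (G : Type) [Group G] [Fintype G]

/-- A configuration: an `n`-tuple of elements of `G`. -/
abbrev Config (n : ℕ) := Fin n → G

/-- The set of generating `n`-tuples. -/
def gens (n : ℕ) : Set (Config G n) :=
  {σ | Subgroup.closure (Set.range σ) = ⊤}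

/-- A move of the product replacement chain: an ordered pair of distinct indices
together with a sign (`true` = multiply, `false` = multiply by inverse). -/
abbrev Move (n : ℕ) := {p : Fin n × Fin n // p.1 ≠ p.2} × Bool

/-- Applying a move: replace `σ i` by `σ i * (σ j)^{±1}`. -/
def applyMove {n : ℕ} (σ : Config G n) (m : Move n) : Config G n :=
  Function.update σ m.1.1.1
    (σ m.1.1.1 * (if m.2 then σ m.1.1.2 else (σ m.1.1.2)⁻¹))

/-- One-step transition probability of the product replacement chain. -/
def step {n : ℕ} (σ σ' : Config G n) : ℝ :=
  ((Finset.univ.filter (fun m : Move n => applyMove G σ m = σ')).card : ℝ) /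
    (Fintype.card (Move n) : ℝ)

/-- The law of `σ_t` for the chain started at `σ₀`. -/
def law {n : ℕ} (σ₀ : Config G n) : ℕ → Config G n → ℝ
  | 0 => fun σ' => if σ' = σ₀ then 1 else 0
  | (t + 1) => fun σ' => ∑ τ : Config G n, law σ₀ t τ * step G τ σ'

/-- Probability that `σ_t ∈ E` for the chain started at `σ₀`. -/
def prob {n : ℕ} (σ₀ : Config G n) (t : ℕ) (E : Set (Config G n)) : ℝ :=
  ∑ τ ∈ Finset.univ.filter (fun τ => τ ∈ E), law G σ₀ t τ

/-- Probability of a trajectory event for the chain started at `σ₀`, over the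
time horizon `{0, 1, …, T}`. -/
def pathProb {n : ℕ} (σ₀ : Config G n) (T : ℕ)
    (E : Set (Fin (T + 1) → Config G n)) : ℝ :=
  ∑ p ∈ Finset.univ.filter
      (fun p : Fin (T + 1) → Config G n => p 0 = σ₀ ∧ p ∈ E),
    ∏ t : Fin T, step G (p t.castSucc) (p t.succ)

/-- `n_a(σ)`: the number of sites holding the group element `a`. -/
def nCount {n : ℕ} (σ : Config G n) (a : G) : ℕ :=
  (Finset.univ.filter (fun i => σ i = a)).card

/-- `n^H_non(σ)`: the number of sites whose element lies outside `H`. -/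
def nNon {n : ℕ} (H : Subgroup G) (σ : Config G n) : ℕ :=
  (Finset.univ.filter (fun i => σ i ∉ H)).card

/-- `n^{id}_non(σ)`: the number of sites not holding the identity. -/
def nNonId {n : ℕ} (σ : Config G n) : ℕ :=
  (Finset.univ.filter (fun i => σ i ≠ 1)).card

/-- `S_non(c)`. -/
def SNon (n : ℕ) (c : ℝ) : Set (Config G n) :=
  {σ | σ ∈ gens G n ∧
    ∀ H : Subgroup G, H ≠ ⊤ → c * n ≤ (nNon G H σ : ℝ)}

/-- The `δ`-typical set `S_*(δ)`. -/
def SAst (n : ℕ) (δ : ℝ) : Set (Config G n) :=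
  {σ | σ ∈ gens G n ∧
    Real.sqrt (∑ a : G, ((nCount G σ a : ℝ) / n - 1 / (Fintype.card G : ℝ)) ^ 2) ≤ δ}

/-- `n^{σ₀}_{a,b}(σ)`. -/
def nab {n : ℕ} (σ₀ σ : Config G n) (a b : G) : ℕ :=
  (Finset.univ.filter (fun i => σ₀ i = a ∧ σ i = b)).card

/-- `S_*(σ₀, r)`. -/
def SAstM {n : ℕ} (σ₀ : Config G n) (r : ℝ) : Set (Config G n) :=
  {σ | σ ∈ gens G n ∧
    ∀ a : G, Real.sqrt (∑ b : G,
      ((nab G σ₀ σ a b : ℝ) / (nCount G σ₀ a : ℝ) - 1 / (Fintype.card G : ℝ)) ^ 2) ≤ r}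

/-- The uniform stationary distribution `π` on the set of generating tuples. -/
def statDist (n : ℕ) : Config G n → ℝ := fun σ =>
  if σ ∈ gens G n then
    1 / ((Finset.univ.filter (fun τ : Config G n => τ ∈ gens G n)).card : ℝ)
  else 0

/-- Total-variation distance between two (finitely supported) signed weights,
as the supremum over finite sets `A` of `|p(A) - q(A)|`. -/
def tvDist {α : Type*} (p q : α → ℝ) : ℝ :=
  sSup {x : ℝ | ∃ A : Finset α, x = |∑ a ∈ A, p a - ∑ a ∈ A, q a|}

/-- `d_σ(t) = max_{A ⊆ S} |P_σ(σ_t ∈ A) - π(A)|`. -/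
def dTV {n : ℕ} (σ : Config G n) (t : ℕ) : ℝ :=
  sSup {x : ℝ | ∃ A : Finset (Config G n), ↑A ⊆ gens G n ∧
    x = |∑ τ ∈ A, law G σ t τ - ∑ τ ∈ A, statDist G n τ|}

/-- `max_{σ ∈ S} d_σ(t)`. -/
def dMax (n : ℕ) (t : ℕ) : ℝ :=
  sSup {x : ℝ | ∃ σ ∈ gens G n, x = dTV G σ t}

end PR

namespace PR

variable {G : Type} [Group G] [Fintype G] {n : ℕ}

/-- The squared `ℓ²`-norm of the difference between `v` and its right translate by `g`. -/
def shiftEnergy (v : G → ℝ) (g : G) : ℝ := ∑ a, (v (a * g) - v a) ^ 2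

lemma shiftEnergy_nonneg (v : G → ℝ) (g : G) : 0 ≤ shiftEnergy v g :=
  Finset.sum_nonneg fun _ _ => sq_nonneg _

lemma shiftEnergy_inv (v : G → ℝ) (g : G) : shiftEnergy v g⁻¹ = shiftEnergy v g := by
  unfold shiftEnergy
  rw [← Equiv.sum_comp (Equiv.mulRight g)]
  refine Finset.sum_congr rfl fun a _ => ?_
  simp only [Equiv.coe_mulRight, mul_inv_cancel_right]
  ring

lemma shiftEnergy_mul_le (v : G → ℝ) (g h : G) :
    shiftEnergy v (g * h) ≤ 2 * shiftEnergy v g + 2 * shiftEnergy v h := by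
  have hh : shiftEnergy v h = ∑ a, (v (a * (g * h)) - v (a * g)) ^ 2 := by
    unfold shiftEnergy
    rw [← Equiv.sum_comp (Equiv.mulRight g)]
    simp [mul_assoc]
  rw [hh]
  unfold shiftEnergy
  rw [Finset.mul_sum, Finset.mul_sum, ← Finset.sum_add_distrib]
  refine Finset.sum_le_sum fun a _ => ?_
  nlinarith [sq_nonneg ((v (a * (g * h)) - v (a * g)) - (v (a * g) - v a))]

lemma sum_mul_sub_shift (v : G → ℝ) (g : G) :
    ∑ a, v a * (v (a * g) - v a) = -(shiftEnergy v g) / 2 := by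
  have h : ∑ a, v (a * g) ^ 2 = ∑ a, v a ^ 2 :=
    Equiv.sum_comp (Equiv.mulRight g) fun a => v a ^ 2
  have h1 : ∑ a, v a * (v (a * g) - v a) =
      (∑ a, v (a * g) ^ 2 - ∑ a, v a ^ 2 - shiftEnergy v g) / 2 := by
    unfold shiftEnergy
    rw [← Finset.sum_sub_distrib, ← Finset.sum_sub_distrib, Finset.sum_div]
    exact Finset.sum_congr rfl fun a _ => by ring
  rw [h1, h]
  ring

lemma sum_shiftEnergy (v : G → ℝ) (hv : ∑ a, v a = 0) :
    ∑ g, shiftEnergy v g = 2 * Fintype.card G * ∑ a, v a ^ 2 := by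
  have h : ∀ g, shiftEnergy v g = 2 * ∑ a, v a ^ 2 - 2 * ∑ a, v a * v (a * g) := by
    intro g
    have h1 := sum_mul_sub_shift v g
    have h2 : ∑ a, v a * (v (a * g) - v a) = ∑ a, v a * v (a * g) - ∑ a, v a ^ 2 := by
      rw [← Finset.sum_sub_distrib]
      exact Finset.sum_congr rfl fun a _ => by ring
    linarith
  have h0 : ∑ g, ∑ a, v a * v (a * g) = 0 := by
    rw [Finset.sum_comm]
    refine Finset.sum_eq_zero fun a _ => ?_
    rw [← Finset.mul_sum, show ∑ g, v (a * g) = ∑ g, v g from Equiv.sum_comp (Equiv.mulLeft a) v, hv, mul_zero]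
  simp only [h]
  rw [Finset.sum_sub_distrib, ← Finset.mul_sum _ _ (2 : ℝ), ← Finset.mul_sum _ _ (2 : ℝ), h0]
  simp
  ring

lemma exists_shiftEnergy_le (B : Finset G) (hB : Subgroup.closure (B : Set G) = ⊤) (g : G) :
    ∃ K : ℝ, 0 ≤ K ∧ ∀ v : G → ℝ, shiftEnergy v g ≤ K * ∑ b ∈ B, shiftEnergy v b := by
  have hg : g ∈ Subgroup.closure (B : Set G) := by rw [hB]; trivial
  induction hg using Subgroup.closure_induction with
  | mem x hx =>
    refine ⟨1, zero_le_one, fun v => ?_⟩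
    rw [one_mul]
    exact Finset.single_le_sum (fun b _ => shiftEnergy_nonneg v b) (Finset.mem_coe.mp hx)
  | one => exact ⟨0, le_rfl, fun v => by simp [shiftEnergy]⟩
  | mul x y _ _ hx hy =>
    obtain ⟨K, hK, hx⟩ := hx
    obtain ⟨L, hL, hy⟩ := hy
    refine ⟨2 * K + 2 * L, by positivity, fun v => ?_⟩
    have := shiftEnergy_mul_le v x y
    linarith [hx v, hy v]
  | inv x _ hx =>
    obtain ⟨K, hK, hx⟩ := hx
    exact ⟨K, hK, fun v => (shiftEnergy_inv v x).trans_le (hx v)⟩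

lemma exists_poincare_generating (G : Type) [Group G] [Fintype G] :
    ∃ κ : ℝ, 0 < κ ∧ ∀ B : Finset G, Subgroup.closure (B : Set G) = ⊤ →
      ∀ v : G → ℝ, ∑ a, v a = 0 → κ * ∑ a, v a ^ 2 ≤ ∑ b ∈ B, shiftEnergy v b := by
  have h : ∀ (B : Finset G) (g : G), ∃ K : ℝ, 0 ≤ K ∧
      (Subgroup.closure (B : Set G) = ⊤ →
        ∀ v : G → ℝ, shiftEnergy v g ≤ K * ∑ b ∈ B, shiftEnergy v b) := by
    intro B g
    by_cases hB : Subgroup.closure (B : Set G) = ⊤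
    · obtain ⟨K, hK, h⟩ := exists_shiftEnergy_le B hB g
      exact ⟨K, hK, fun _ => h⟩
    · exact ⟨0, le_rfl, fun h => absurd h hB⟩
  choose K hK hKle using h
  have hM : 0 ≤ ∑ B, ∑ g, K B g :=
    Finset.sum_nonneg fun B _ => Finset.sum_nonneg fun g _ => hK B g
  refine ⟨(∑ B, ∑ g, K B g + 1)⁻¹, by positivity, fun B hB v hv => ?_⟩
  rw [inv_mul_le_iff₀ (by positivity)]
  set E := ∑ b ∈ B, shiftEnergy v b
  have hE : 0 ≤ E := Finset.sum_nonneg fun b _ => shiftEnergy_nonneg v b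
  have h1 : ∑ g, shiftEnergy v g ≤ (∑ g, K B g) * E := by
    rw [Finset.sum_mul]
    exact Finset.sum_le_sum fun g _ => hKle B g hB v
  have h2 : ∑ g, K B g ≤ ∑ B, ∑ g, K B g :=
    Finset.single_le_sum (f := fun B => ∑ g, K B g)
      (fun B _ => Finset.sum_nonneg fun g _ => hK B g) (Finset.mem_univ B)
  have h3 : (1 : ℝ) ≤ Fintype.card G := by exact_mod_cast Fintype.card_pos
  have h4 : 0 ≤ ∑ a, v a ^ 2 := Finset.sum_nonneg fun a _ => sq_nonneg _
  rw [sum_shiftEnergy v hv] at h1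
  nlinarith [mul_le_mul_of_nonneg_right h2 hE, mul_le_mul_of_nonneg_right h3 h4]

/-- A Poincaré inequality for weights that give mass at least `s` to the complement of every
proper subgroup. -/
lemma exists_poincare (G : Type) [Group G] [Fintype G] :
    ∃ κ : ℝ, 0 < κ ∧ ∀ (w : G → ℝ) (s : ℝ), (∀ b, 0 ≤ w b) → 0 < s →
      (∀ H : Subgroup G, H ≠ ⊤ → s ≤ ∑ b, if b ∉ H then w b else 0) →
      ∀ v : G → ℝ, ∑ a, v a = 0 →
        κ * s * ∑ a, v a ^ 2 ≤ ∑ b, w b * shiftEnergy v b := by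
  obtain ⟨κ, hκ, h⟩ := exists_poincare_generating G
  have hQ : (0 : ℝ) < Fintype.card G := by exact_mod_cast Fintype.card_pos
  refine ⟨κ / (2 * Fintype.card G), by positivity, fun w s hw hs hH v hv => ?_⟩
  set r : ℝ := s / (2 * Fintype.card G) with hr
  have hr0 : 0 < r := by positivity
  set B : Finset G := Finset.univ.filter fun b => r ≤ w b with hBdef
  have hB : Subgroup.closure (B : Set G) = ⊤ := by
    by_contra hne
    have h1 := hH _ hne
    have h2 : ∑ b, (if b ∉ Subgroup.closure (B : Set G) then w b else 0) ≤ ∑ _b : G, r := by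
      refine Finset.sum_le_sum fun b _ => ?_
      split_ifs with hb
      · exact hr0.le
      · by_contra! hlt
        exact hb (Subgroup.subset_closure (by simp [hBdef, hlt.le]))
    have h3 : ∑ _b : G, r = s / 2 := by
      simp [hr]
      field_simp
    linarith
  have h1 := h B hB v hv
  calc κ / (2 * Fintype.card G) * s * ∑ a, v a ^ 2 = r * (κ * ∑ a, v a ^ 2) := by
        rw [hr]; ring
    _ ≤ r * ∑ b ∈ B, shiftEnergy v b := by gcongr
    _ ≤ ∑ b ∈ B, w b * shiftEnergy v b := by
        rw [Finset.mul_sum]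
        refine Finset.sum_le_sum fun b hb => ?_
        exact mul_le_mul_of_nonneg_right (Finset.mem_filter.mp hb).2 (shiftEnergy_nonneg v b)
    _ ≤ ∑ b, w b * shiftEnergy v b :=
        Finset.sum_le_sum_of_subset_of_nonneg (Finset.subset_univ _)
          fun b _ _ => mul_nonneg (hw b) (shiftEnergy_nonneg v b)

/-- The average of `f` after one move of the chain from `σ`. -/
def moveAvg (f : Config G n → ℝ) (σ : Config G n) : ℝ :=
  (∑ m : Move n, f (applyMove G σ m)) / Fintype.card (Move n)

/-- The expectation of `f (σ_t)` for the chain started at `σ₀`. -/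
def expect (σ₀ : Config G n) (t : ℕ) (f : Config G n → ℝ) : ℝ :=
  ∑ τ, law G σ₀ t τ * f τ

lemma sum_step_mul (τ : Config G n) (f : Config G n → ℝ) :
    ∑ τ', step G τ τ' * f τ' = moveAvg f τ := by
  unfold step moveAvg
  rw [← Finset.sum_fiberwise Finset.univ (fun m => applyMove G τ m)
    (fun m => f (applyMove G τ m)), Finset.sum_div]
  refine Finset.sum_congr rfl fun τ' _ => ?_
  rw [Finset.sum_congr rfl (g := fun _ => f τ')
    (fun m hm => by rw [(Finset.mem_filter.mp hm).2]), Finset.sum_const, nsmul_eq_mul]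
  ring

lemma expect_zero (σ₀ : Config G n) (f : Config G n → ℝ) : expect σ₀ 0 f = f σ₀ := by
  simp [expect, law]

lemma expect_succ (σ₀ : Config G n) (t : ℕ) (f : Config G n → ℝ) :
    expect σ₀ (t + 1) f = expect σ₀ t (moveAvg f) := by
  simp only [expect, law, Finset.sum_mul]
  rw [Finset.sum_comm]
  refine Finset.sum_congr rfl fun τ _ => ?_
  rw [← sum_step_mul, Finset.mul_sum]
  exact Finset.sum_congr rfl fun τ' _ => by ring

lemma law_nonneg (σ₀ : Config G n) (t : ℕ) (τ : Config G n) : 0 ≤ law G σ₀ t τ := by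
  induction t generalizing τ with
  | zero => simp only [law]; split_ifs <;> norm_num
  | succ t ih =>
    exact Finset.sum_nonneg fun τ' _ => mul_nonneg (ih τ') (by unfold step; positivity)

lemma law_eq_zero_of_notMem {A : Set (Config G n)} {σ₀ : Config G n} (h₀ : σ₀ ∈ A)
    (hA : ∀ σ ∈ A, ∀ m, applyMove G σ m ∈ A) (t : ℕ) {τ : Config G n} (hτ : τ ∉ A) :
    law G σ₀ t τ = 0 := by
  induction t generalizing τ with
  | zero =>
    simp only [law]
    rw [if_neg]
    rintro rfl
    exact hτ h₀
  | succ t ih =>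
    refine Finset.sum_eq_zero fun τ' _ => ?_
    by_cases h : τ' ∈ A
    · have : step G τ' τ = 0 := by
        unfold step
        rw [Finset.filter_false_of_mem]
        · simp
        · rintro m - rfl
          exact hτ (hA τ' h m)
      rw [this, mul_zero]
    · rw [ih h, zero_mul]

lemma expect_mono_on {A : Set (Config G n)} {σ₀ : Config G n} (h₀ : σ₀ ∈ A)
    (hA : ∀ σ ∈ A, ∀ m, applyMove G σ m ∈ A) (t : ℕ) {f g : Config G n → ℝ}
    (hfg : ∀ τ ∈ A, f τ ≤ g τ) : expect σ₀ t f ≤ expect σ₀ t g := by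
  refine Finset.sum_le_sum fun τ _ => ?_
  by_cases h : τ ∈ A
  · exact mul_le_mul_of_nonneg_left (hfg τ h) (law_nonneg _ _ _)
  · rw [law_eq_zero_of_notMem h₀ hA t h, zero_mul, zero_mul]

lemma expect_mono (σ₀ : Config G n) (t : ℕ) {f g : Config G n → ℝ} (hfg : ∀ τ, f τ ≤ g τ) :
    expect σ₀ t f ≤ expect σ₀ t g :=
  expect_mono_on (A := Set.univ) trivial (fun _ _ _ => trivial) t fun τ _ => hfg τ

lemma expect_add (σ₀ : Config G n) (t : ℕ) (f g : Config G n → ℝ) :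
    expect σ₀ t (fun τ => f τ + g τ) = expect σ₀ t f + expect σ₀ t g := by
  simp only [expect, mul_add, Finset.sum_add_distrib]

lemma expect_const_mul (σ₀ : Config G n) (t : ℕ) (c : ℝ) (f : Config G n → ℝ) :
    expect σ₀ t (fun τ => c * f τ) = c * expect σ₀ t f := by
  simp only [expect, Finset.mul_sum]
  exact Finset.sum_congr rfl fun τ _ => by ring

lemma card_move (n : ℕ) : (Fintype.card (Move n) : ℝ) = 2 * n * (n - 1) := by
  have h : Fintype.card {p : Fin n × Fin n // p.1 ≠ p.2} = n * n - n := by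
    have h1 := Fintype.card_subtype_compl (fun p : Fin n × Fin n => p.1 = p.2)
    have h2 : Fintype.card {p : Fin n × Fin n // p.1 = p.2} = n := by
      have e : {p : Fin n × Fin n // p.1 = p.2} ≃ Fin n :=
        { toFun := fun p => p.1.1
          invFun := fun i => ⟨(i, i), rfl⟩
          left_inv := by rintro ⟨⟨i, j⟩, h⟩; simp at h; simp [h]
          right_inv := fun i => rfl }
      rw [Fintype.card_congr e, Fintype.card_fin]
    rw [Fintype.card_prod, Fintype.card_fin] at h1
    rw [← h2]
    convert h1
  rw [Fintype.card_prod, h, Fintype.card_bool]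
  push_cast [Nat.cast_sub (Nat.le_mul_self n)]
  ring

lemma card_move_pos (hn : 2 ≤ n) : (0 : ℝ) < Fintype.card (Move n) := by
  have : (2 : ℝ) ≤ n := by exact_mod_cast hn
  rw [card_move]
  have : (0 : ℝ) < n - 1 := by linarith
  positivity

omit [Fintype G] in
lemma moveAvg_le (hn : 2 ≤ n) {f : Config G n → ℝ} {c : ℝ} {σ : Config G n}
    (h : ∀ m, f (applyMove G σ m) ≤ c) : moveAvg f σ ≤ c := by
  unfold moveAvg
  rw [div_le_iff₀ (card_move_pos hn)]
  calc ∑ m, f (applyMove G σ m) ≤ ∑ _m : Move n, c := Finset.sum_le_sum fun m _ => h m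
    _ = c * Fintype.card (Move n) := by simp [mul_comm]

lemma expect_const (hn : 2 ≤ n) (σ₀ : Config G n) (t : ℕ) (c : ℝ) :
    expect σ₀ t (fun _ => c) = c := by
  induction t with
  | zero => rw [expect_zero]
  | succ t ih =>
    rw [expect_succ]
    convert ih using 2
    funext τ
    have := (card_move_pos hn).ne'
    simp only [moveAvg, Finset.sum_const, Finset.card_univ, nsmul_eq_mul]
    field_simp

lemma prob_eq_expect (σ₀ : Config G n) (t : ℕ) (E : Set (Config G n)) :
    prob G σ₀ t E = expect σ₀ t (fun τ => if τ ∈ E then 1 else 0) := by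
  simp [prob, expect, Finset.sum_filter]

/-- A uniform bound from a one-step affine recursion. -/
lemma le_of_affine_recursion {u : ℕ → ℝ} {ρ b : ℝ} (hρ : 0 ≤ ρ) (hρ1 : ρ < 1)
    (hb : 0 ≤ b) (h : ∀ t, u (t + 1) ≤ ρ * u t + b) (t : ℕ) :
    u t ≤ ρ ^ t * u 0 + b / (1 - ρ) := by
  have h1 : 0 < 1 - ρ := by linarith
  induction t with
  | zero => have : 0 ≤ b / (1 - ρ) := by positivity
            simp; linarith
  | succ t ih =>
    have h2 : ρ * (b / (1 - ρ)) + b = b / (1 - ρ) := by field_simp; ring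
    calc u (t + 1) ≤ ρ * u t + b := h t
      _ ≤ ρ * (ρ ^ t * u 0 + b / (1 - ρ)) + b := by gcongr
      _ = ρ ^ (t + 1) * u 0 + (ρ * (b / (1 - ρ)) + b) := by ring
      _ = _ := by rw [h2]

lemma sum_move (g : Fin n → Fin n → Bool → ℝ) :
    ∑ m : Move n, g m.1.1.1 m.1.1.2 m.2 =
      ∑ i, ∑ j, ∑ ε, g i j ε - ∑ i, ∑ ε, g i i ε := by
  have h : ∀ i, ∑ j, ∑ ε, g i j ε =
      ∑ j, (if i ≠ j then ∑ ε, g i j ε else 0) + ∑ ε, g i i ε := by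
    intro i
    rw [← Finset.sum_filter, ← Finset.sum_filter_add_sum_filter_not _ (fun j => i ≠ j)]
    congr 1
    rw [Finset.sum_filter]
    simp
  simp only [h, Finset.sum_add_distrib]
  rw [Fintype.sum_prod_type, add_sub_cancel_right,
    ← Fintype.sum_prod_type' (f := fun i j => if i ≠ j then ∑ ε, g i j ε else 0),
    ← Finset.sum_filter]
  exact (Finset.sum_subtype _ (by simp) (fun p : Fin n × Fin n => ∑ ε, g p.1 p.2 ε)).symm

/-- The value written by a move. -/
def moveValue (σ : Config G n) (i j : Fin n) (ε : Bool) : G :=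
  σ i * (if ε then σ j else (σ j)⁻¹)

omit [Fintype G] in
lemma applyMove_eq (σ : Config G n) (m : Move n) :
    applyMove G σ m = Function.update σ m.1.1.1 (moveValue σ m.1.1.1 m.1.1.2 m.2) := rfl

omit [Fintype G] in
lemma sum_applyMove (φ : G → ℝ) (σ : Config G n) (m : Move n) :
    ∑ l, φ (applyMove G σ m l) =
      ∑ l, φ (σ l) - φ (σ m.1.1.1) + φ (moveValue σ m.1.1.1 m.1.1.2 m.2) := by
  rw [applyMove_eq]
  have h := Finset.sum_update_of_mem (Finset.mem_univ m.1.1.1) (fun l => φ (σ l))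
    (φ (moveValue σ m.1.1.1 m.1.1.2 m.2))
  have h2 : ∀ l, φ (Function.update σ m.1.1.1 (moveValue σ m.1.1.1 m.1.1.2 m.2) l) =
      Function.update (fun l => φ (σ l)) m.1.1.1 (φ (moveValue σ m.1.1.1 m.1.1.2 m.2)) l := by
    intro l
    by_cases hl : l = m.1.1.1
    · subst hl; simp
    · simp [hl]
  simp only [h2]
  rw [h, ← Finset.add_sum_erase _ (fun l => φ (σ l)) (Finset.mem_univ m.1.1.1),
    Finset.sdiff_singleton_eq_erase]
  ring

omit [Fintype G] in
lemma nNon_eq_sum (H : Subgroup G) (σ : Config G n) :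
    (nNon G H σ : ℝ) = ∑ i, if σ i ∉ H then (1 : ℝ) else 0 := by
  rw [Finset.sum_boole, nNon]

omit [Group G] [Fintype G] in
lemma nCount_eq_sum (σ : Config G n) (a : G) :
    (nCount G σ a : ℝ) = ∑ i, if σ i = a then (1 : ℝ) else 0 := by
  simp [nCount]

omit [Group G] in
lemma sum_nCount_mul (σ : Config G n) (φ : G → ℝ) :
    ∑ a, nCount G σ a * φ a = ∑ i, φ (σ i) := by
  simp only [nCount_eq_sum, Finset.sum_mul]
  rw [Finset.sum_comm]
  exact Finset.sum_congr rfl fun i _ => by simp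

omit [Fintype G] in
lemma one_le_nNon_applyMove {H : Subgroup G} {σ : Config G n} (h : 1 ≤ nNon G H σ)
    (m : Move n) : 1 ≤ nNon G H (applyMove G σ m) := by
  have key : ∀ τ : Config G n, 1 ≤ nNon G H τ ↔ ∃ l, τ l ∉ H := by
    intro τ
    unfold nNon
    rw [Nat.one_le_iff_ne_zero, ← Nat.pos_iff_ne_zero, Finset.card_pos]
    exact ⟨fun ⟨l, hl⟩ => ⟨l, (Finset.mem_filter.mp hl).2⟩,
      fun ⟨l, hl⟩ => ⟨l, Finset.mem_filter.mpr ⟨Finset.mem_univ l, hl⟩⟩⟩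
  rw [key] at h ⊢
  by_contra! hall
  obtain ⟨⟨⟨i, j⟩, hij⟩, ε⟩ := m
  have hne : ∀ l, l ≠ i → σ l ∈ H := by
    intro l hl
    simpa [applyMove, hl] using hall l
  have hj : σ j ∈ H := hne j (Ne.symm hij)
  have hi : σ i ∈ H := by
    have h1 := hall i
    cases ε
    · simpa [applyMove, Subgroup.mul_mem_cancel_right, hj] using h1
    · simpa [applyMove, Subgroup.mul_mem_cancel_right, hj] using h1
  obtain ⟨l, hl⟩ := h
  by_cases hli : l = i
  · exact hl (hli ▸ hi)
  · exact hl (hne l hli)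

/-- The indicator of `a ∉ H`. -/
def nonInd (H : Subgroup G) (a : G) : ℝ := if a ∉ H then 1 else 0

omit [Fintype G] in
lemma nNon_eq_sum_nonInd (H : Subgroup G) (σ : Config G n) :
    (nNon G H σ : ℝ) = ∑ i, nonInd H (σ i) := nNon_eq_sum H σ

omit [Fintype G] in
lemma pow_nNon_applyMove_le (H : Subgroup G) (σ : Config G n) (m : Move n) :
    (2 / 3 : ℝ) ^ nNon G H (applyMove G σ m) ≤ (2 / 3 : ℝ) ^ nNon G H σ *
      (1 + (-(1 / 3) * ((1 - nonInd H (σ m.1.1.1)) * nonInd H (σ m.1.1.2)) +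
        1 / 2 * (nonInd H (σ m.1.1.1) * nonInd H (σ m.1.1.2)))) := by
  have hk := sum_applyMove (nonInd H) σ m
  rw [← nNon_eq_sum_nonInd, ← nNon_eq_sum_nonInd] at hk
  obtain ⟨⟨⟨i, j⟩, hij⟩, ε⟩ := m
  dsimp only at hk ⊢
  have hx : (if ε then σ j else (σ j)⁻¹) ∈ H ↔ σ j ∈ H := by cases ε <;> simp
  have hpos : (0 : ℝ) < (2 / 3 : ℝ) ^ nNon G H σ := by positivity
  set k := nNon G H σ
  set k' := nNon G H (applyMove G σ (⟨(i, j), hij⟩, ε))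
  unfold moveValue at hk
  by_cases hi : σ i ∈ H <;> by_cases hj : σ j ∈ H
  · have h1 : σ i * (if ε then σ j else (σ j)⁻¹) ∈ H := H.mul_mem hi (hx.mpr hj)
    simp only [nonInd, hi, hj, h1] at hk ⊢
    have : k' = k := by norm_num at hk; exact_mod_cast hk
    rw [this]; norm_num
  · have h1 : σ i * (if ε then σ j else (σ j)⁻¹) ∉ H := by
      rw [H.mul_mem_cancel_left hi, hx]; exact hj
    simp only [nonInd, hi, hj, h1] at hk ⊢
    have : k' = k + 1 := by norm_num at hk; exact_mod_cast hk
    rw [this, pow_succ]; norm_num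
  · have h1 : σ i * (if ε then σ j else (σ j)⁻¹) ∉ H := by
      rw [H.mul_mem_cancel_right (hx.mpr hj)]; exact hi
    simp only [nonInd, hi, hj, h1] at hk ⊢
    have : k' = k := by norm_num at hk; exact_mod_cast hk
    rw [this]; norm_num
  · by_cases h1 : σ i * (if ε then σ j else (σ j)⁻¹) ∈ H
    · simp only [nonInd, hi, hj, h1] at hk ⊢
      have : k' + 1 = k := by
        norm_num at hk
        have : (k' : ℝ) + 1 = k := by linarith
        exact_mod_cast this
      rw [← this, pow_succ]; norm_num; linarith
    · simp only [nonInd, hi, hj, h1] at hk ⊢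
      have : k' = k := by norm_num at hk; exact_mod_cast hk
      rw [this]; norm_num

omit [Fintype G] in
lemma moveAvg_pow_nNon_le (hn : 2 ≤ n) (H : Subgroup G) (σ : Config G n) :
    moveAvg (fun τ => (2 / 3 : ℝ) ^ nNon G H τ) σ ≤ (2 / 3 : ℝ) ^ nNon G H σ *
      (1 + nNon G H σ * (5 * nNon G H σ - 2 * n) / (6 * n * (n - 1))) := by
  set k : ℝ := (nNon G H σ : ℝ) with hk
  have hn' : (2 : ℝ) ≤ n := by exact_mod_cast hn
  have hn1 : (0 : ℝ) < n - 1 := by linarith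
  have hM := card_move_pos hn
  have hsq : ∀ a, nonInd H a * nonInd H a = nonInd H a := by
    intro a; unfold nonInd; split_ifs <;> norm_num
  have hcalc : ∑ m : Move n,
      (-(1 / 3) * ((1 - nonInd H (σ m.1.1.1)) * nonInd H (σ m.1.1.2)) +
        1 / 2 * (nonInd H (σ m.1.1.1) * nonInd H (σ m.1.1.2))) =
      2 * (-(1 / 3) * ((n - k) * k) + 1 / 2 * (k * k - k)) := by
    rw [sum_move fun i j _ => -(1 / 3) * ((1 - nonInd H (σ i)) * nonInd H (σ j)) +
        1 / 2 * (nonInd H (σ i) * nonInd H (σ j))]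
    have hd : ∀ i, (1 - nonInd H (σ i)) * nonInd H (σ i) = 0 := by
      intro i; linarith [hsq (σ i)]
    simp only [hd, hsq, Finset.sum_add_distrib, ← Finset.mul_sum, ← Finset.sum_mul,
      Finset.sum_sub_distrib, Finset.sum_const, Finset.card_univ, Fintype.card_bool,
      Fintype.card_fin, ← nNon_eq_sum_nonInd, ← hk, nsmul_eq_mul]
    push_cast
    ring
  unfold moveAvg
  rw [div_le_iff₀ hM]
  refine (Finset.sum_le_sum fun m _ => pow_nNon_applyMove_le H σ m).trans ?_
  rw [← Finset.mul_sum, Finset.sum_add_distrib, hcalc, mul_assoc]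
  gcongr
  rw [Finset.sum_const, Finset.card_univ, nsmul_eq_mul, card_move, add_mul]
  have h0 : (0 : ℝ) ≤ k := by positivity
  have : k * (5 * k - 2 * n) / (6 * n * (n - 1)) * (2 * n * (n - 1)) =
      k * (5 * k - 2 * n) / 3 := by field_simp; ring
  rw [this]
  nlinarith

lemma two_thirds_pow_eq (k : ℕ) :
    (2 / 3 : ℝ) ^ k = Real.exp (-Real.log (3 / 2) * k) := by
  rw [mul_comm, Real.exp_nat_mul, Real.exp_neg, Real.exp_log (by norm_num)]
  norm_num

omit [Fintype G] in
lemma moveAvg_pow_nNon_le_affine (hn : 2 ≤ n) {H : Subgroup G} {σ : Config G n}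
    (h : 1 ≤ nNon G H σ) :
    moveAvg (fun τ => (2 / 3 : ℝ) ^ nNon G H τ) σ ≤
      (1 - 1 / (48 * n)) * (2 / 3 : ℝ) ^ nNon G H σ +
        3 / 2 * Real.exp (-Real.log (3 / 2) * (3 * n / 8)) := by
  have hn' : (2 : ℝ) ≤ n := by exact_mod_cast hn
  have hn1 : (0 : ℝ) < n - 1 := by linarith
  have hk1 : (1 : ℝ) ≤ nNon G H σ := by exact_mod_cast h
  have hpos : (0 : ℝ) < (2 / 3 : ℝ) ^ nNon G H σ := by positivity
  rcases le_or_gt (8 * (nNon G H σ : ℝ)) (3 * n) with hle | hgt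
  · have h1 : 1 + nNon G H σ * (5 * nNon G H σ - 2 * n) / (6 * n * (n - 1)) ≤
        1 - 1 / (48 * (n : ℝ)) := by
      have : (nNon G H σ : ℝ) * (5 * nNon G H σ - 2 * n) / (6 * n * (n - 1)) ≤
          -(1 / (48 * (n : ℝ))) := by
        rw [div_le_iff₀ (by positivity)]
        have : -(1 / (48 * (n : ℝ))) * (6 * n * (n - 1)) = -(n - 1) / 8 := by
          field_simp; ring
        rw [this]
        nlinarith
      linarith
    have h2 := (moveAvg_pow_nNon_le hn H σ).trans (mul_le_mul_of_nonneg_left h1 hpos.le)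
    have h3 := Real.exp_pos (-Real.log (3 / 2) * (3 * n / 8))
    linarith
  · have h1 : moveAvg (fun τ => (2 / 3 : ℝ) ^ nNon G H τ) σ ≤
        3 / 2 * (2 / 3 : ℝ) ^ nNon G H σ := by
      refine moveAvg_le hn fun m => (pow_nNon_applyMove_le H σ m).trans ?_
      rw [mul_comm]
      gcongr
      unfold nonInd
      split_ifs <;> norm_num
    have h2 : (2 / 3 : ℝ) ^ nNon G H σ ≤ Real.exp (-Real.log (3 / 2) * (3 * n / 8)) := by
      rw [two_thirds_pow_eq, Real.exp_le_exp]
      have : 0 < Real.log (3 / 2) := Real.log_pos (by norm_num)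
      nlinarith
    have h3 : 0 ≤ (1 - 1 / (48 * n)) * (2 / 3 : ℝ) ^ nNon G H σ := by
      refine mul_nonneg ?_ hpos.le
      rw [sub_nonneg, div_le_one (by positivity)]
      linarith
    linarith

lemma expect_nNon_lt_le (hn : 2 ≤ n) {H : Subgroup G} {σ : Config G n}
    (h : 1 / 3 * (n : ℝ) ≤ nNon G H σ) (t : ℕ) :
    expect σ t (fun τ => if (nNon G H τ : ℝ) < n / 4 then 1 else 0) ≤
      73 * n * Real.exp (-Real.log (3 / 2) / 12 * n) := by
  set β := Real.log (3 / 2) with hβ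
  have hβ0 : 0 < β := Real.log_pos (by norm_num)
  have hn' : (2 : ℝ) ≤ n := by exact_mod_cast hn
  have h1 : 1 ≤ nNon G H σ := by
    have : (0 : ℝ) < nNon G H σ := by linarith
    exact_mod_cast this
  set ρ : ℝ := 1 - 1 / (48 * n) with hρ
  have hinv : 1 / (48 * (n : ℝ)) ≤ 1 := by
    rw [div_le_one (by positivity)]; linarith
  have hρ0 : 0 ≤ ρ := by linarith
  have hinv0 : 0 < 1 / (48 * (n : ℝ)) := by positivity
  have hρ1 : ρ < 1 := by linarith
  have hrec : ∀ s, expect σ (s + 1) (fun τ => (2 / 3 : ℝ) ^ nNon G H τ) ≤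
      ρ * expect σ s (fun τ => (2 / 3 : ℝ) ^ nNon G H τ) +
        3 / 2 * Real.exp (-β * (3 * n / 8)) := by
    intro s
    rw [expect_succ, ← expect_const_mul, ← expect_const hn σ s (3 / 2 * _), ← expect_add]
    exact expect_mono_on (A := {τ | 1 ≤ nNon G H τ}) h1
      (fun τ hτ m => one_le_nNon_applyMove hτ m) s
      fun τ hτ => moveAvg_pow_nNon_le_affine hn hτ
  have hle := le_of_affine_recursion
    (u := fun s => expect σ s (fun τ => (2 / 3 : ℝ) ^ nNon G H τ))
    (b := 3 / 2 * Real.exp (-β * (3 * n / 8))) hρ0 hρ1 (by positivity) hrec t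
  simp only [expect_zero] at hle
  have hb : 3 / 2 * Real.exp (-β * (3 * n / 8)) / (1 - ρ) =
      72 * n * Real.exp (-β * (3 * n / 8)) := by
    rw [hρ, sub_sub_cancel]; field_simp; norm_num
  rw [hb] at hle
  have hstart : (2 / 3 : ℝ) ^ nNon G H σ ≤ Real.exp (-β * (n / 3)) := by
    rw [two_thirds_pow_eq, Real.exp_le_exp]
    nlinarith
  have hstart' : ρ ^ t * (2 / 3 : ℝ) ^ nNon G H σ ≤ Real.exp (-β * (n / 3)) :=
    (mul_le_of_le_one_left (by positivity) (pow_le_one₀ hρ0 hρ1.le)).trans hstart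
  have hind : expect σ t (fun τ => if (nNon G H τ : ℝ) < n / 4 then 1 else 0) ≤
      Real.exp (β * (n / 4)) * expect σ t (fun τ => (2 / 3 : ℝ) ^ nNon G H τ) := by
    rw [← expect_const_mul]
    refine expect_mono σ t fun τ => ?_
    split_ifs with hlt
    · rw [two_thirds_pow_eq, ← Real.exp_add, Real.one_le_exp_iff, ← hβ]
      nlinarith
    · positivity
  calc _ ≤ _ := hind
    _ ≤ Real.exp (β * (n / 4)) * (Real.exp (-β * (n / 3)) +
        72 * n * Real.exp (-β * (3 * n / 8))) := by gcongr; linarith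
    _ = Real.exp (-β / 12 * n) + 72 * n * Real.exp (-β / 8 * n) := by
        rw [mul_add, ← Real.exp_add, mul_left_comm, ← Real.exp_add]
        congr 3 <;> ring
    _ ≤ n * Real.exp (-β / 12 * n) + 72 * n * Real.exp (-β / 12 * n) := by
        have h2 : Real.exp (-β / 8 * n) ≤ Real.exp (-β / 12 * n) := by
          rw [Real.exp_le_exp]; nlinarith
        have h3 := Real.exp_pos (-β / 12 * n)
        gcongr
        nlinarith
    _ = _ := by ring

/-- Some proper subgroup has fewer than a quarter of the sites outside it. -/
def Concentrated (σ : Config G n) : Prop :=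
  ∃ H : Subgroup G, H ≠ ⊤ ∧ (nNon G H σ : ℝ) < n / 4

lemma expect_concentrated_le (hn : 2 ≤ n) {σ : Config G n} (hσ : σ ∈ SNon G n (1 / 3)) (t : ℕ) :
    expect σ t (fun τ => if Concentrated τ then 1 else 0) ≤
      Fintype.card (Subgroup G) * (73 * n * Real.exp (-Real.log (3 / 2) / 12 * n)) := by
  have h1 : expect σ t (fun τ => if Concentrated τ then 1 else 0) ≤
      expect σ t (fun τ => ∑ H : Subgroup G,
        if H ≠ ⊤ ∧ (nNon G H τ : ℝ) < n / 4 then 1 else 0) := by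
    refine expect_mono σ t fun τ => ?_
    split_ifs with hc
    · obtain ⟨H, hH⟩ := hc
      have := Finset.single_le_sum (f := fun H : Subgroup G =>
        if H ≠ ⊤ ∧ (nNon G H τ : ℝ) < n / 4 then (1 : ℝ) else 0)
        (fun H _ => by split_ifs <;> norm_num) (Finset.mem_univ H)
      simpa only [if_pos hH] using this
    · positivity
  refine h1.trans ?_
  have h2 : expect σ t (fun τ => ∑ H : Subgroup G,
        if H ≠ ⊤ ∧ (nNon G H τ : ℝ) < n / 4 then (1 : ℝ) else 0) =
      ∑ H : Subgroup G, expect σ t (fun τ =>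
        if H ≠ ⊤ ∧ (nNon G H τ : ℝ) < n / 4 then 1 else 0) := by
    simp only [expect, Finset.mul_sum]
    exact Finset.sum_comm
  rw [h2, ← nsmul_eq_mul, ← Finset.card_univ, ← Finset.sum_const]
  refine Finset.sum_le_sum fun H _ => ?_
  by_cases hH : H = ⊤
  · simp only [hH, ne_eq, not_true, false_and, if_false]
    rw [expect_const hn]
    positivity
  · simp only [ne_eq, hH, not_false_iff, true_and]
    exact expect_nNon_lt_le hn (hσ.2 H hH) t

/-- The deviation of the count of `a` from its mean under uniformity. -/
def deviation (σ : Config G n) (a : G) : ℝ := nCount G σ a - n / Fintype.card G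

/-- The squared `ℓ²`-norm of the deviation. -/
def sqDeviation (σ : Config G n) : ℝ := ∑ a, deviation σ a ^ 2

omit [Group G] in
lemma sum_nCount (σ : Config G n) : ∑ a, (nCount G σ a : ℝ) = n := by
  simpa using sum_nCount_mul σ (fun _ => 1)

lemma sum_deviation (σ : Config G n) : ∑ a, deviation σ a = 0 := by
  have hQ : (Fintype.card G : ℝ) ≠ 0 := by exact_mod_cast Fintype.card_ne_zero
  simp only [deviation, Finset.sum_sub_distrib, sum_nCount, Finset.sum_const, Finset.card_univ,
    nsmul_eq_mul]
  field_simp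
  ring

omit [Group G] [Fintype G] in
lemma nCount_le (σ : Config G n) (a : G) : (nCount G σ a : ℝ) ≤ n := by
  have : nCount G σ a ≤ n := (Finset.card_le_univ _).trans_eq (Fintype.card_fin n)
  exact_mod_cast this

omit [Group G] in
lemma abs_deviation_sub_le (σ : Config G n) (a b : G) :
    |deviation σ a - deviation σ b| ≤ n := by
  have h1 := nCount_le σ a
  have h2 := nCount_le σ b
  have h3 : (0 : ℝ) ≤ nCount G σ a := by positivity
  have h4 : (0 : ℝ) ≤ nCount G σ b := by positivity
  unfold deviation
  rw [abs_le]
  constructor <;> linarith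

lemma sqDeviation_le (σ : Config G n) : sqDeviation σ ≤ (n : ℝ) ^ 2 := by
  have h0 := sum_deviation σ
  have h1 : sqDeviation σ = ∑ a, (nCount G σ a : ℝ) * deviation σ a := by
    have : ∑ a, (nCount G σ a : ℝ) * deviation σ a =
        sqDeviation σ + n / Fintype.card G * ∑ a, deviation σ a := by
      rw [sqDeviation, Finset.mul_sum, ← Finset.sum_add_distrib]
      exact Finset.sum_congr rfl fun a _ => by unfold deviation; ring
    rw [this, h0]; ring
  rw [h1, sq]
  nth_rw 1 [← sum_nCount σ]
  rw [Finset.sum_mul]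
  refine Finset.sum_le_sum fun a _ => ?_
  have : deviation σ a ≤ n := by
    have h2 : (0 : ℝ) ≤ n / Fintype.card G := by positivity
    have := nCount_le σ a
    unfold deviation; linarith
  gcongr

/-- The difference between the deviations of the value a move writes and the value it erases. -/
def moveDrift (σ : Config G n) (i j : Fin n) (ε : Bool) : ℝ :=
  deviation σ (moveValue σ i j ε) - deviation σ (σ i)

lemma sqDeviation_applyMove (σ : Config G n) (m : Move n) :
    2 * moveDrift σ m.1.1.1 m.1.1.2 m.2 ≤ sqDeviation (applyMove G σ m) - sqDeviation σ ∧
    sqDeviation (applyMove G σ m) - sqDeviation σ ≤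
      2 * moveDrift σ m.1.1.1 m.1.1.2 m.2 + 2 := by
  set c := moveValue σ m.1.1.1 m.1.1.2 m.2 with hc
  set i := m.1.1.1 with hi
  set d : G → ℝ := fun a => (if c = a then 1 else 0) - (if σ i = a then 1 else 0) with hd
  have hdev : ∀ a, deviation (applyMove G σ m) a = deviation σ a + d a := by
    intro a
    have := sum_applyMove (fun x => if x = a then (1 : ℝ) else 0) σ m
    rw [← nCount_eq_sum, ← nCount_eq_sum] at this
    unfold deviation
    rw [this]
    simp only [hd, hc, hi]
    ring
  have hsum : sqDeviation (applyMove G σ m) - sqDeviation σ =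
      2 * moveDrift σ i m.1.1.2 m.2 + ∑ a, d a ^ 2 := by
    have h1 : 2 * moveDrift σ i m.1.1.2 m.2 = ∑ a, 2 * (deviation σ a * d a) := by
      rw [← Finset.mul_sum]
      simp [hd, mul_sub, moveDrift, ← hc]
    rw [h1, ← Finset.sum_add_distrib]
    simp only [sqDeviation, hdev]
    rw [← Finset.sum_sub_distrib]
    exact Finset.sum_congr rfl fun a _ => by ring
  have hle : ∑ a, d a ^ 2 ≤ 2 := by
    have h1 : ∑ a, ((if c = a then (1 : ℝ) else 0) + (if σ i = a then 1 else 0)) = 2 := by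
      rw [Finset.sum_add_distrib]; simp; norm_num
    rw [← h1]
    refine Finset.sum_le_sum fun a _ => ?_
    simp only [hd]
    split_ifs <;> norm_num
  have hge : 0 ≤ ∑ a, d a ^ 2 := Finset.sum_nonneg fun a _ => sq_nonneg _
  constructor <;> linarith

lemma abs_sqDeviation_applyMove_sub_le (hn : 2 ≤ n) (σ : Config G n) (m : Move n) :
    |sqDeviation (applyMove G σ m) - sqDeviation σ| ≤ 4 * n := by
  have hn' : (2 : ℝ) ≤ n := by exact_mod_cast hn
  have h := abs_le.mp (abs_deviation_sub_le σ (moveValue σ m.1.1.1 m.1.1.2 m.2) (σ m.1.1.1))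
  obtain ⟨h1, h2⟩ := sqDeviation_applyMove σ m
  unfold moveDrift at h1 h2
  rw [abs_le]
  constructor <;> linarith

lemma sum_moveDrift_le (σ : Config G n) :
    ∑ m : Move n, moveDrift σ m.1.1.1 m.1.1.2 m.2 ≤
      2 * (n : ℝ) ^ 2 - ∑ b, nCount G σ b * shiftEnergy (deviation σ) b := by
  have hone : ∀ x : G, ∑ i, (deviation σ (σ i * x) - deviation σ (σ i)) =
      -(shiftEnergy (deviation σ) x) / 2 := by
    intro x
    rw [← sum_nCount_mul σ (fun a => deviation σ (a * x) - deviation σ a),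
      ← sum_mul_sub_shift]
    have h0 : ∑ a, (deviation σ (a * x) - deviation σ a) = 0 := by
      rw [Finset.sum_sub_distrib, sub_eq_zero]
      exact Equiv.sum_comp (Equiv.mulRight x) (deviation σ)
    rw [← sub_eq_zero, ← Finset.sum_sub_distrib]
    calc _ = ∑ a, n / Fintype.card G * (deviation σ (a * x) - deviation σ a) :=
          Finset.sum_congr rfl fun a _ => by simp only [deviation]; ring
      _ = 0 := by rw [← Finset.mul_sum, h0, mul_zero]
  have hfull : ∑ i, ∑ j, ∑ ε, moveDrift σ i j ε =
      -∑ b, nCount G σ b * shiftEnergy (deviation σ) b := by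
    rw [sum_nCount_mul, Finset.sum_comm, ← Finset.sum_neg_distrib]
    refine Finset.sum_congr rfl fun j _ => ?_
    simp only [Fintype.sum_bool, Finset.sum_add_distrib, moveDrift, moveValue, if_true,
      Bool.false_eq_true, if_false]
    rw [hone, hone, shiftEnergy_inv]
    ring
  have hdiag : -(2 * (n : ℝ) ^ 2) ≤ ∑ i, ∑ ε, moveDrift σ i i ε := by
    have : ∑ _i : Fin n, ∑ _ε : Bool, -(n : ℝ) = -(2 * (n : ℝ) ^ 2) := by
      simp; ring
    rw [← this]
    refine Finset.sum_le_sum fun i _ => Finset.sum_le_sum fun ε _ => ?_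
    exact (abs_le.mp (abs_deviation_sub_le σ _ _)).1
  rw [sum_move (moveDrift σ), hfull]
  linarith

/-- The exponential Lyapunov function of the chain. -/
def expDeviation (c : ℝ) (σ : Config G n) : ℝ := Real.exp (c / n * sqDeviation σ)

lemma expDeviation_le (hn : 2 ≤ n) {c : ℝ} (hc : 0 ≤ c) (σ : Config G n) :
    expDeviation c σ ≤ Real.exp (c * n) := by
  have hn' : (2 : ℝ) ≤ n := by exact_mod_cast hn
  unfold expDeviation
  rw [Real.exp_le_exp, div_mul_eq_mul_div, div_le_iff₀ (by linarith)]
  nlinarith [sqDeviation_le σ]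

lemma expDeviation_applyMove_le (hn : 2 ≤ n) {c : ℝ} (hc : 0 ≤ c) (hc1 : 4 * c ≤ 1)
    (σ : Config G n) (m : Move n) :
    expDeviation c (applyMove G σ m) ≤ expDeviation c σ *
      (1 + (c / n * (2 * moveDrift σ m.1.1.1 m.1.1.2 m.2 + 2) + 16 * c ^ 2)) ∧
    expDeviation c (applyMove G σ m) ≤ expDeviation c σ * Real.exp 1 := by
  have hn' : (2 : ℝ) ≤ n := by exact_mod_cast hn
  set x := c / n * (sqDeviation (applyMove G σ m) - sqDeviation σ) with hx
  have hx4 : |x| ≤ 4 * c := by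
    rw [hx, abs_mul, abs_of_nonneg (by positivity)]
    calc _ ≤ c / n * (4 * n) := by
          gcongr; exact abs_sqDeviation_applyMove_sub_le hn σ m
      _ = 4 * c := by field_simp
  have heq : expDeviation c (applyMove G σ m) = expDeviation c σ * Real.exp x := by
    unfold expDeviation
    rw [← Real.exp_add, hx]
    congr 1; ring
  have hpos : 0 < expDeviation c σ := Real.exp_pos _
  rw [heq]
  refine ⟨?_, ?_⟩
  · gcongr
    have h1 := (abs_le.mp (Real.abs_exp_sub_one_sub_id_le (hx4.trans hc1))).2
    have h2 : x ^ 2 ≤ 16 * c ^ 2 := by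
      rw [← sq_abs]
      nlinarith [abs_nonneg x]
    have h3 : x ≤ c / n * (2 * moveDrift σ m.1.1.1 m.1.1.2 m.2 + 2) := by
      rw [hx]
      gcongr
      exact (sqDeviation_applyMove σ m).2
    linarith
  · gcongr
    exact (le_abs_self x).trans (hx4.trans hc1)

lemma moveAvg_expDeviation_le (hn : 2 ≤ n) {c : ℝ} (hc : 0 ≤ c) (hc1 : 4 * c ≤ 1)
    (σ : Config G n) :
    moveAvg (expDeviation c) σ ≤ expDeviation c σ *
      (1 + (16 * c ^ 2 + c / n *
        (6 - (∑ b, nCount G σ b * shiftEnergy (deviation σ) b) / (n : ℝ) ^ 2))) := by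
  have hn' : (2 : ℝ) ≤ n := by exact_mod_cast hn
  have hM := card_move_pos hn
  set M : ℝ := (Fintype.card (Move n) : ℝ) with hMdef
  set S := ∑ b, nCount G σ b * shiftEnergy (deviation σ) b with hS
  have hS0 : 0 ≤ S := Finset.sum_nonneg fun b _ =>
    mul_nonneg (by positivity) (shiftEnergy_nonneg _ b)
  have hpos : 0 < expDeviation c σ := Real.exp_pos _
  have hmul : 2 * (2 * (n : ℝ) ^ 2 - S) ≤ (4 - S / (n : ℝ) ^ 2) * M := by
    have hcard : M = 2 * n * (n - 1) := card_move n
    have h1 : S / (n : ℝ) ^ 2 * M ≤ 2 * S := by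
      rw [hcard, div_mul_eq_mul_div, div_le_iff₀ (by positivity)]
      nlinarith
    have h2 : (n : ℝ) ^ 2 ≤ M := by rw [hcard]; nlinarith
    nlinarith
  unfold moveAvg
  rw [← hMdef, div_le_iff₀ hM]
  refine (Finset.sum_le_sum fun m _ => (expDeviation_applyMove_le hn hc hc1 σ m).1).trans ?_
  rw [← Finset.mul_sum, mul_assoc]
  gcongr
  simp only [Finset.sum_add_distrib, ← Finset.mul_sum, Finset.sum_const, Finset.card_univ,
    nsmul_eq_mul, ← hMdef]
  have h3 := mul_le_mul_of_nonneg_left (hmul.trans' (mul_le_mul_of_nonneg_left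
    (sum_moveDrift_le σ) zero_le_two)) (show 0 ≤ c / n by positivity)
  linarith

lemma exists_sqDeviation_le_energy (G : Type) [Group G] [Fintype G] :
    ∃ κ : ℝ, 0 < κ ∧ ∀ (n : ℕ) (σ : Config G n), 2 ≤ n → ¬ Concentrated σ →
      κ * n * sqDeviation σ ≤ ∑ b, nCount G σ b * shiftEnergy (deviation σ) b := by
  obtain ⟨κ, hκ, h⟩ := exists_poincare G
  refine ⟨κ / 4, by positivity, fun n σ hn hσ => ?_⟩
  have hn' : (2 : ℝ) ≤ n := by exact_mod_cast hn
  have := h (fun b => nCount G σ b) (n / 4) (fun b => by positivity) (by positivity)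
    (fun H hH => by
      have h1 : (n : ℝ) / 4 ≤ nNon G H σ := by
        by_contra! hlt
        exact hσ ⟨H, hH, hlt⟩
      rw [nNon_eq_sum, ← sum_nCount_mul σ (fun a => if a ∉ H then (1 : ℝ) else 0)] at h1
      simpa only [mul_ite, mul_one, mul_zero] using h1)
    (deviation σ) (sum_deviation σ)
  calc κ / 4 * n * sqDeviation σ = κ * (n / 4) * ∑ a, deviation σ a ^ 2 := by
        rw [sqDeviation]; ring
    _ ≤ _ := this

lemma moveAvg_expDeviation_le_affine {κ η c : ℝ} (hη : 0 < η) (hc : 0 < c)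
    (hc1 : 4 * c ≤ 1) (hcκ : 64 * c ≤ κ * η) (hcη : c * (κ * η) ≤ 1) (hn : 2 ≤ n)
    (hnη : 24 ≤ κ * η * n) (hκ : 0 < κ) {σ : Config G n}
    (h : ¬ Concentrated σ →
      κ * n * sqDeviation σ ≤ ∑ b, nCount G σ b * shiftEnergy (deviation σ) b) :
    moveAvg (expDeviation c) σ ≤ (1 - c * (κ * η) / 2) * expDeviation c σ +
      (Real.exp 1 * Real.exp (c * η * n) +
        Real.exp (c * n) * if Concentrated σ then 1 else 0) := by
  have hn' : (2 : ℝ) ≤ n := by exact_mod_cast hn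
  have hpos : 0 < expDeviation c σ := Real.exp_pos _
  have hρ : 0 ≤ (1 - c * (κ * η) / 2) * expDeviation c σ :=
    mul_nonneg (by linarith) hpos.le
  have he : 0 < Real.exp 1 * Real.exp (c * η * n) := by positivity
  by_cases hconc : Concentrated σ
  · rw [if_pos hconc]
    have := moveAvg_le hn (σ := σ) fun m => expDeviation_le hn hc.le (applyMove G σ m)
    linarith
  rw [if_neg hconc]
  rcases le_or_gt (sqDeviation σ) (η * (n : ℝ) ^ 2) with hle | hgt
  · have h1 := moveAvg_le hn (σ := σ) fun m => (expDeviation_applyMove_le hn hc.le hc1 σ m).2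
    have h2 : expDeviation c σ ≤ Real.exp (c * η * n) := by
      unfold expDeviation
      rw [Real.exp_le_exp]
      calc c / n * sqDeviation σ ≤ c / n * (η * (n : ℝ) ^ 2) := by gcongr
        _ = c * η * n := by field_simp
    have h3 := mul_le_mul_of_nonneg_right h2 (Real.exp_pos 1).le
    linarith
  · have h1 := moveAvg_expDeviation_le hn hc.le hc1 σ
    set S := ∑ b, nCount G σ b * shiftEnergy (deviation σ) b
    have h2 : κ * η * n ≤ S / (n : ℝ) ^ 2 := by
      rw [le_div_iff₀ (by positivity)]
      calc κ * η * n * (n : ℝ) ^ 2 = κ * n * (η * (n : ℝ) ^ 2) := by ring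
        _ ≤ κ * n * sqDeviation σ := by gcongr
        _ ≤ S := h hconc
    have h3 : 1 + (16 * c ^ 2 + c / n * (6 - S / (n : ℝ) ^ 2)) ≤ 1 - c * (κ * η) / 2 := by
      have h4 : c / n * (6 - S / (n : ℝ) ^ 2) ≤ c / n * (-(3 / 4) * (κ * η * n)) := by
        gcongr
        linarith
      have h5 : c / n * (-(3 / 4) * (κ * η * n)) = -(3 / 4) * (c * (κ * η)) := by
        field_simp
      nlinarith
    have h6 := mul_le_mul_of_nonneg_left h3 hpos.le
    linarith

lemma notMem_SAst {δ : ℝ} (hδ : 0 < δ) (hn : 2 ≤ n) {τ : Config G n} (h : τ ∉ SAst G n δ) :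
    Concentrated τ ∨ δ ^ 2 * (n : ℝ) ^ 2 < sqDeviation τ := by
  have hn' : (2 : ℝ) ≤ n := by exact_mod_cast hn
  by_contra! hcon
  obtain ⟨h1, h2⟩ := hcon
  refine h ⟨?_, ?_⟩
  · by_contra hne
    refine h1 ⟨_, hne, ?_⟩
    have : nNon G (Subgroup.closure (Set.range τ)) τ = 0 := by
      unfold nNon
      rw [Finset.card_eq_zero, Finset.filter_eq_empty_iff]
      exact fun i _ => not_not.mpr (Subgroup.subset_closure ⟨i, rfl⟩)
    rw [this, Nat.cast_zero]
    positivity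
  · rw [Real.sqrt_le_left hδ.le]
    calc _ = sqDeviation τ / (n : ℝ) ^ 2 := by
          rw [sqDeviation, Finset.sum_div]
          refine Finset.sum_congr rfl fun a _ => ?_
          unfold deviation
          field_simp
      _ ≤ δ ^ 2 := by rwa [div_le_iff₀ (by positivity)]

lemma prob_compl_SAst_le {η δ c : ℝ} (hδ : 0 < δ) (hη : δ ^ 2 = 2 * η) (hc : 0 < c)
    (hn : 2 ≤ n) (σ : Config G n) (t : ℕ) :
    prob G σ t {τ | τ ∉ SAst G n δ} ≤
      expect σ t (fun τ => if Concentrated τ then 1 else 0) +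
        Real.exp (-(2 * c * η * n)) * expect σ t (expDeviation c) := by
  have hn' : (2 : ℝ) ≤ n := by exact_mod_cast hn
  rw [prob_eq_expect, ← expect_const_mul, ← expect_add]
  refine expect_mono σ t fun τ => ?_
  have h0 : 0 < Real.exp (-(2 * c * η * n)) * expDeviation c τ :=
    mul_pos (Real.exp_pos _) (Real.exp_pos _)
  by_cases hτ : τ ∈ SAst G n δ
  · rw [if_neg (by simpa using hτ)]
    split_ifs <;> linarith
  · rw [if_pos (by simpa using hτ)]
    rcases notMem_SAst hδ hn hτ with h | h
    · rw [if_pos h]; linarith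
    · have h1 : 1 ≤ Real.exp (-(2 * c * η * n)) * expDeviation c τ := by
        unfold expDeviation
        rw [← Real.exp_add, Real.one_le_exp_iff]
        have h2 : c / n * (δ ^ 2 * (n : ℝ) ^ 2) ≤ c / n * sqDeviation τ := by gcongr
        have h3 : c / n * (δ ^ 2 * (n : ℝ) ^ 2) = 2 * c * η * n := by
          rw [hη]; field_simp
        linarith
      split_ifs <;> linarith

lemma exists_expect_expDeviation_le (G : Type) [Group G] [Fintype G] {η : ℝ} (hη : 0 < η) :
    ∃ (c C A : ℝ) (N : ℕ), 0 < c ∧ 2 ≤ N ∧ ∀ n : ℕ, N ≤ n → ∀ σ ∈ SNon G n (1 / 3),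
      ∀ t : ℕ, C * n ≤ t →
        expect σ t (expDeviation c) ≤ A * (n * Real.exp (c * η * n)) := by
  obtain ⟨κ, hκ, hpoinc⟩ := exists_sqDeviation_le_energy G
  set β := Real.log (3 / 2) with hβ
  have hβ0 : 0 < β := Real.log_pos (by norm_num)
  have hκη : 0 < κ * η := by positivity
  obtain ⟨c, hc, hc1, hcκ, hcη, hcβ⟩ : ∃ c : ℝ, 0 < c ∧ 4 * c ≤ 1 ∧ 64 * c ≤ κ * η ∧
      c * (κ * η) ≤ 1 ∧ 12 * c ≤ β := by
    refine ⟨min (min (1 / 4) (κ * η / 64)) (min (1 / (κ * η)) (β / 12)), by positivity,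
      ?_, ?_, ?_, ?_⟩
    · have := (min_le_left (min (1 / 4) (κ * η / 64)) (min (1 / (κ * η)) (β / 12))).trans
        (min_le_left _ _)
      linarith
    · have := (min_le_left (min (1 / 4) (κ * η / 64)) (min (1 / (κ * η)) (β / 12))).trans
        (min_le_right _ _)
      linarith
    · have := (min_le_right (min (1 / 4) (κ * η / 64)) (min (1 / (κ * η)) (β / 12))).trans
        (min_le_left _ _)
      rwa [le_div_iff₀ hκη] at this
    · have := (min_le_right (min (1 / 4) (κ * η / 64)) (min (1 / (κ * η)) (β / 12))).trans
        (min_le_right _ _)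
      linarith
  set ε := c * (κ * η) / 2 with hε
  have hε0 : 0 < ε := by positivity
  set R : ℝ := (Fintype.card (Subgroup G) : ℝ) with hR
  refine ⟨c, c / ε, 1 + (Real.exp 1 + 73 * R) / ε, max 2 ⌈24 / (κ * η)⌉₊, hc,
    le_max_left _ _, fun n hN σ hσ t ht => ?_⟩
  have hn : 2 ≤ n := (le_max_left _ _).trans hN
  have hn' : (2 : ℝ) ≤ n := by exact_mod_cast hn
  have hnη : 24 ≤ κ * η * n := by
    have h1 : 24 / (κ * η) ≤ (n : ℝ) := Nat.ceil_le.mp ((le_max_right _ _).trans hN)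
    rw [div_le_iff₀ hκη] at h1
    linarith
  have hE : 1 ≤ Real.exp (c * η * n) := Real.one_le_exp (by positivity)
  have hrec : ∀ s, expect σ (s + 1) (expDeviation c) ≤
      (1 - ε) * expect σ s (expDeviation c) +
        (Real.exp 1 + 73 * R) * (n * Real.exp (c * η * n)) := by
    intro s
    have h1 : expect σ (s + 1) (expDeviation c) ≤ (1 - ε) * expect σ s (expDeviation c) +
        (Real.exp 1 * Real.exp (c * η * n) +
          Real.exp (c * n) * expect σ s (fun τ => if Concentrated τ then 1 else 0)) := by
      rw [expect_succ, ← expect_const_mul, ← expect_const_mul,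
        ← expect_const hn σ s (Real.exp 1 * _), ← expect_add, ← expect_add]
      exact expect_mono σ s fun τ => moveAvg_expDeviation_le_affine hη hc hc1 hcκ hcη hn hnη hκ
        (hpoinc n τ hn)
    have h2 : Real.exp (c * n) * expect σ s (fun τ => if Concentrated τ then 1 else 0) ≤
        73 * R * n := by
      calc _ ≤ Real.exp (c * n) * (R * (73 * n * Real.exp (-β / 12 * n))) := by
            gcongr; exact expect_concentrated_le hn hσ s
        _ = 73 * R * n * Real.exp (c * n + -β / 12 * n) := by rw [Real.exp_add]; ring
        _ ≤ 73 * R * n * 1 := by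
            gcongr
            rw [Real.exp_le_one_iff]
            nlinarith
        _ = 73 * R * n := mul_one _
    have h3 : Real.exp 1 * Real.exp (c * η * n) ≤ Real.exp 1 * (n * Real.exp (c * η * n)) := by
      gcongr
      nlinarith
    have h4 : 73 * R * n ≤ 73 * R * (n * Real.exp (c * η * n)) := by
      gcongr
      nlinarith
    linarith
  have hle := le_of_affine_recursion (u := fun s => expect σ s (expDeviation c))
    (b := (Real.exp 1 + 73 * R) * (n * Real.exp (c * η * n)))
    (by linarith) (by linarith) (by positivity) hrec t
  simp only [expect_zero, sub_sub_cancel] at hle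
  have hstart : (1 - ε) ^ t * expDeviation c σ ≤ n * Real.exp (c * η * n) := by
    calc (1 - ε) ^ t * expDeviation c σ ≤ Real.exp (-ε) ^ t * Real.exp (c * n) := by
          gcongr
          · exact (Real.exp_pos _).le
          · linarith
          · linarith [Real.add_one_le_exp (-ε)]
          · exact expDeviation_le hn hc.le σ
      _ = Real.exp (t * -ε + c * n) := by rw [Real.exp_add, Real.exp_nat_mul]
      _ ≤ 1 := by
          rw [Real.exp_le_one_iff]
          have h1 := mul_le_mul_of_nonneg_right ht hε0.le
          have h2 : c / ε * n * ε = c * n := by field_simp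
          linarith
      _ ≤ n * Real.exp (c * η * n) := by nlinarith
  calc _ ≤ _ := hle
    _ ≤ n * Real.exp (c * η * n) +
        (Real.exp 1 + 73 * R) * (n * Real.exp (c * η * n)) / ε := by gcongr
    _ = _ := by ring

lemma tendsto_sq_mul_exp_neg (b : ℝ) (hb : 0 < b) :
    Tendsto (fun n : ℕ => (n : ℝ) ^ 2 * Real.exp (-b * n)) atTop (nhds 0) := by
  have := (tendsto_rpow_mul_exp_neg_mul_atTop_nhds_zero 2 b hb).comp
    (tendsto_natCast_atTop_atTop (R := ℝ))
  refine this.congr fun n => ?_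
  simp

end PR

/-- Lemma 2.2: for any constant `δ > 0` there is a constant `C_{G,δ}` such
that for all large enough `n`, any `σ ∈ S_non(1/3)` and any time `T ≥ C_{G,δ} n`,
`Pr_σ(σ_T ∉ S_*(δ)) ≤ 1/n`. -/
theorem reach_typical_set
    (G : Type) [Group G] [Fintype G] :
    ∀ δ : ℝ, 0 < δ →
      ∃ (C : ℝ) (N : ℕ), ∀ n : ℕ, N ≤ n → ∀ σ ∈ PR.SNon G n (1 / 3),
        ∀ T : ℕ, C * n ≤ (T : ℝ) →
          PR.prob G σ T {τ | τ ∉ PR.SAst G n δ} ≤ 1 / n := by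
  intro δ hδ
  have hη : 0 < δ ^ 2 / 2 := by positivity
  obtain ⟨c, C, A, N, hc, hN, h⟩ := PR.exists_expect_expDeviation_le G hη
  set η := δ ^ 2 / 2 with hηdef
  have hβ : 0 < Real.log (3 / 2) / 12 :=
    div_pos (Real.log_pos (by norm_num)) (by norm_num)
  set R : ℝ := (Fintype.card (Subgroup G) : ℝ) with hR
  have hlim := ((PR.tendsto_sq_mul_exp_neg _ hβ).const_mul (73 * R)).add
    ((PR.tendsto_sq_mul_exp_neg (c * η) (by positivity)).const_mul A)
  rw [mul_zero, mul_zero, add_zero] at hlim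
  obtain ⟨N', hN'⟩ := eventually_atTop.mp (hlim.eventually_le_const zero_lt_one)
  refine ⟨C, max N N', fun n hn σ hσ T hT => ?_⟩
  have hNn : N ≤ n := (le_max_left _ _).trans hn
  have hn2 : 2 ≤ n := hN.trans hNn
  have hn0 : (0 : ℝ) < n := by exact_mod_cast (by lia : 0 < n)
  have hsmall := hN' n ((le_max_right _ _).trans hn)
  have hprob := PR.prob_compl_SAst_le hδ (η := η) (by rw [hηdef]; ring) hc hn2 σ T
  have hconc := PR.expect_concentrated_le hn2 hσ T
  have hexp := mul_le_mul_of_nonneg_left (h n hNn σ hσ T hT)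
    (Real.exp_pos (-(2 * c * η * n))).le
  have hcomb : Real.exp (-(2 * c * η * n)) * (A * (n * Real.exp (c * η * n))) =
      A * (n * Real.exp (-(c * η) * n)) := by
    rw [show -(c * η) * n = -(2 * c * η * n) + c * η * n by ring, Real.exp_add]
    ring
  rw [hcomb] at hexp
  rw [le_div_iff₀ hn0]
  rw [neg_div] at hconc
  calc _ ≤ (R * (73 * n * Real.exp (-(Real.log (3 / 2) / 12) * n)) +
        A * (n * Real.exp (-(c * η) * n))) * n := by
        gcongr
        linarith
    _ = 73 * R * ((n : ℝ) ^ 2 * Real.exp (-(Real.log (3 / 2) / 12) * n)) +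
        A * ((n : ℝ) ^ 2 * Real.exp (-(c * η) * n)) := by ring
    _ ≤ 1 := hsmall
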